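/- Let F : M^m × [0,T) → R^n be a smooth mean curvature flow whose normal bundle is flat for all t, and let w be defined by F*ω = w dμ for a parallel unit m-form ω on R^n. Then w satisfies the evolution equation d/dt w = Δw + w|A|². -/

import Mathlib

noncomputable section

open Real Finset

/-- Partial derivative of a scalar function on `ℝ^m` in direction `i`. -/
def pd {m : ℕ} (f : (Fin m → ℝ) → ℝ) (i : Fin m) (x : Fin m → ℝ) : ℝ :=
  fderiv ℝ f x (Pi.single i 1)

/-- Components `F^α_i` of the differential of an immersion `F : ℝ^m → ℝ^n`. -/
def Fd {m n : ℕ} (F : (Fin m → ℝ) → (Fin n → ℝ)) (α : Fin n) (i : Fin m)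
    (x : Fin m → ℝ) : ℝ :=
  pd (fun y => F y α) i x

/-- Induced metric `g_{ij} = ⟨F_i, F_j⟩`. -/
def gInd {m n : ℕ} (F : (Fin m → ℝ) → (Fin n → ℝ)) (i j : Fin m) (x : Fin m → ℝ) : ℝ :=
  ∑ α, Fd F α i x * Fd F α j x

/-- Induced metric as a matrix. -/
def gMat {m n : ℕ} (F : (Fin m → ℝ) → (Fin n → ℝ)) (x : Fin m → ℝ) :
    Matrix (Fin m) (Fin m) ℝ :=
  fun i j => gInd F i j x

/-- Inverse metric `g^{ij}`. -/
def gInv {m n : ℕ} (F : (Fin m → ℝ) → (Fin n → ℝ)) (i j : Fin m) (x : Fin m → ℝ) : ℝ :=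
  (gMat F x)⁻¹ i j

/-- Christoffel symbols `Γ^k_{ij}` of the induced metric. -/
def chr {m n : ℕ} (F : (Fin m → ℝ) → (Fin n → ℝ)) (k i j : Fin m) (x : Fin m → ℝ) : ℝ :=
  (1/2) * ∑ l, gInv F k l x *
    (pd (gInd F l j) i x + pd (gInd F l i) j x - pd (gInd F i j) l x)

/-- Second fundamental form `A^α_{ij} = F^α_{ij} - Γ^k_{ij} F^α_k`. -/
def sff {m n : ℕ} (F : (Fin m → ℝ) → (Fin n → ℝ)) (α : Fin n) (i j : Fin m)
    (x : Fin m → ℝ) : ℝ :=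
  pd (fun y => Fd F α j y) i x - ∑ k, chr F k i j x * Fd F α k x

/-- Mean curvature vector `H^α = g^{ij} A^α_{ij}`. -/
def mcv {m n : ℕ} (F : (Fin m → ℝ) → (Fin n → ℝ)) (α : Fin n) (x : Fin m → ℝ) : ℝ :=
  ∑ i, ∑ j, gInv F i j x * sff F α i j x

/-- Riemann curvature tensor `R^l_{kij}` of the induced metric. -/
def riem {m n : ℕ} (F : (Fin m → ℝ) → (Fin n → ℝ)) (l k i j : Fin m) (x : Fin m → ℝ) : ℝ :=
  pd (fun y => chr F l j k y) i x - pd (fun y => chr F l i k y) j x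
    + ∑ p, (chr F l i p x * chr F p j k x - chr F l j p x * chr F p i k x)

/-- Riemann curvature tensor with all indices lowered, `R_{ijkl} = g_{ip} R^p_{jkl}`. -/
def riemLow {m n : ℕ} (F : (Fin m → ℝ) → (Fin n → ℝ)) (i j k l : Fin m) (x : Fin m → ℝ) : ℝ :=
  ∑ p, gInd F i p x * riem F p j k l x

/-- Ricci curvature `R_{ij} = R^k_{ikj}` of the induced metric. -/
def ricci {m n : ℕ} (F : (Fin m → ℝ) → (Fin n → ℝ)) (i j : Fin m) (x : Fin m → ℝ) : ℝ :=
  ∑ k, riem F k i k j x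

/-- Tangential projector `T^α_β = g^{ij} F^α_i F^β_j` onto the tangent space. -/
def tanP {m n : ℕ} (F : (Fin m → ℝ) → (Fin n → ℝ)) (α β : Fin n) (x : Fin m → ℝ) : ℝ :=
  ∑ i, ∑ j, gInv F i j x * Fd F α i x * Fd F β j x

/-- Normal projector `N = id - T` onto the normal bundle. -/
def norP {m n : ℕ} (F : (Fin m → ℝ) → (Fin n → ℝ)) (α β : Fin n) (x : Fin m → ℝ) : ℝ :=
  (if α = β then 1 else 0) - tanP F α β x

/-- Derivative of the normal projector. -/
def dnorP {m n : ℕ} (F : (Fin m → ℝ) → (Fin n → ℝ)) (i : Fin m) (α β : Fin n)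
    (x : Fin m → ℝ) : ℝ :=
  pd (fun y => norP F α β y) i x

/-- Curvature `R^{αβ}_{ij}` of the normal connection (the connection `N ∘ d` on the
normal bundle `im N`), given by the standard formula `N (∂_i N ∂_j N - ∂_j N ∂_i N) N`. -/
def normCurv {m n : ℕ} (F : (Fin m → ℝ) → (Fin n → ℝ)) (α β : Fin n) (i j : Fin m)
    (x : Fin m → ℝ) : ℝ :=
  ∑ γ, ∑ δ, ∑ ε,
    norP F α γ x * (dnorP F i γ δ x * dnorP F j δ ε x - dnorP F j γ δ x * dnorP F i δ ε x)
      * norP F ε β x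

/-- Covariant derivative `∇_l A^α_{ij}` of the second fundamental form, using the full
induced connection (the pullback connection on `F⁻¹Tℝⁿ` is flat in cartesian coordinates). -/
def covA {m n : ℕ} (F : (Fin m → ℝ) → (Fin n → ℝ)) (l : Fin m) (α : Fin n) (i j : Fin m)
    (x : Fin m → ℝ) : ℝ :=
  pd (fun y => sff F α i j y) l x - ∑ k, chr F k l i x * sff F α k j x
    - ∑ k, chr F k l j x * sff F α i k x

/-- Second covariant derivative `∇_p ∇_l A^α_{ij}`. -/
def cov2A {m n : ℕ} (F : (Fin m → ℝ) → (Fin n → ℝ)) (p l : Fin m) (α : Fin n) (i j : Fin m)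
    (x : Fin m → ℝ) : ℝ :=
  pd (fun y => covA F l α i j y) p x - ∑ k, chr F k p l x * covA F k α i j x
    - ∑ k, chr F k p i x * covA F l α k j x - ∑ k, chr F k p j x * covA F l α i k x

/-- Covariant Hessian `∇_l ∇_k H^α` of the mean curvature vector. -/
def hessH {m n : ℕ} (F : (Fin m → ℝ) → (Fin n → ℝ)) (α : Fin n) (l k : Fin m)
    (x : Fin m → ℝ) : ℝ :=
  pd (fun y => pd (fun z => mcv F α z) k y) l x - ∑ p, chr F p l k x * pd (fun z => mcv F α z) p x

/-- Covariant derivative `∇_l R_{ij}` of the Ricci tensor. -/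
def covRic {m n : ℕ} (F : (Fin m → ℝ) → (Fin n → ℝ)) (l i j : Fin m) (x : Fin m → ℝ) : ℝ :=
  pd (fun y => ricci F i j y) l x - ∑ p, chr F p l i x * ricci F p j x
    - ∑ p, chr F p l j x * ricci F i p x

/-- The tensor `a_{ij} = g_{αβ} H^α A^β_{ij}`. -/
def aT {m n : ℕ} (F : (Fin m → ℝ) → (Fin n → ℝ)) (i j : Fin m) (x : Fin m → ℝ) : ℝ :=
  ∑ α, mcv F α x * sff F α i j x

/-- The tensor `b_{ij} = g_{αβ} A^α_{ik} A^{βk}_j`. -/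
def bT {m n : ℕ} (F : (Fin m → ℝ) → (Fin n → ℝ)) (i j : Fin m) (x : Fin m → ℝ) : ℝ :=
  ∑ α, ∑ k, ∑ l, gInv F k l x * sff F α i k x * sff F α j l x

/-- Squared norm `|H|²` of the mean curvature vector. -/
def normH2 {m n : ℕ} (F : (Fin m → ℝ) → (Fin n → ℝ)) (x : Fin m → ℝ) : ℝ :=
  ∑ α, (mcv F α x) ^ 2

/-- Squared norm `|A|²` of the second fundamental form. -/
def normA2 {m n : ℕ} (F : (Fin m → ℝ) → (Fin n → ℝ)) (x : Fin m → ℝ) : ℝ :=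
  ∑ α, ∑ i, ∑ j, ∑ k, ∑ l,
    gInv F i k x * gInv F j l x * sff F α i j x * sff F α k l x

/-- Squared norm `|a_{ij}|²`. -/
def normaT2 {m n : ℕ} (F : (Fin m → ℝ) → (Fin n → ℝ)) (x : Fin m → ℝ) : ℝ :=
  ∑ i, ∑ j, ∑ k, ∑ l, gInv F i k x * gInv F j l x * aT F i j x * aT F k l x

/-- Components `∇_i H^α + a_i^l F^α_l` of the normal covariant derivative of `H`. -/
def nperpH {m n : ℕ} (F : (Fin m → ℝ) → (Fin n → ℝ)) (i : Fin m) (α : Fin n)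
    (x : Fin m → ℝ) : ℝ :=
  pd (fun y => mcv F α y) i x + ∑ l, ∑ k, gInv F l k x * aT F i k x * Fd F α l x

/-- Squared norm `|∇^⊥ H|²`. -/
def normNperpH2 {m n : ℕ} (F : (Fin m → ℝ) → (Fin n → ℝ)) (x : Fin m → ℝ) : ℝ :=
  ∑ α, ∑ i, ∑ j, gInv F i j x * nperpH F i α x * nperpH F j α x

/-- Components `∇_l A^α_{ij} + A^β_{ij} A^k_{βl} F^α_k` of the normal covariant
derivative of `A`. -/
def nperpA {m n : ℕ} (F : (Fin m → ℝ) → (Fin n → ℝ)) (l : Fin m) (α : Fin n) (i j : Fin m)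
    (x : Fin m → ℝ) : ℝ :=
  covA F l α i j x + ∑ β, ∑ k, ∑ p, sff F β i j x * gInv F k p x * sff F β p l x * Fd F α k x

/-- Squared norm `|∇^⊥ A|²`. -/
def normNperpA2 {m n : ℕ} (F : (Fin m → ℝ) → (Fin n → ℝ)) (x : Fin m → ℝ) : ℝ :=
  ∑ α, ∑ l, ∑ l', ∑ i, ∑ i', ∑ j, ∑ j',
    gInv F l l' x * gInv F i i' x * gInv F j j' x * nperpA F l α i j x * nperpA F l' α i' j' x

/-- The symmetric bilinear form `S^{αβ} = A^{αm}_n A^{βn}_m` on the normal bundle. -/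
def ssf {m n : ℕ} (F : (Fin m → ℝ) → (Fin n → ℝ)) (α β : Fin n) (x : Fin m → ℝ) : ℝ :=
  ∑ i, ∑ j, (∑ k, gInv F i k x * sff F α k j x) * (∑ p, gInv F j p x * sff F β p i x)

/-- Squared norm `|A^{αm}_n A^{βn}_m|²`. -/
def normSsf2 {m n : ℕ} (F : (Fin m → ℝ) → (Fin n → ℝ)) (x : Fin m → ℝ) : ℝ :=
  ∑ α, ∑ β, (ssf F α β x) ^ 2

/-- Squared norm `|R^⊥|²` of the normal curvature. -/
def normRperp2 {m n : ℕ} (F : (Fin m → ℝ) → (Fin n → ℝ)) (x : Fin m → ℝ) : ℝ :=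
  ∑ α, ∑ β, ∑ i, ∑ j, ∑ k, ∑ l,
    gInv F i k x * gInv F j l x * normCurv F α β i j x * normCurv F α β k l x

/-- Riemannian volume density `√(det g)`. -/
def volDens {m n : ℕ} (F : (Fin m → ℝ) → (Fin n → ℝ)) (x : Fin m → ℝ) : ℝ :=
  Real.sqrt (gMat F x).det

/-- Laplace–Beltrami operator on scalar functions, `Δf = g^{ij}(∂_i∂_j f - Γ^k_{ij} ∂_k f)`. -/
def lapBel {m n : ℕ} (F : (Fin m → ℝ) → (Fin n → ℝ)) (f : (Fin m → ℝ) → ℝ)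
    (x : Fin m → ℝ) : ℝ :=
  ∑ i, ∑ j, gInv F i j x * (pd (fun y => pd f i y) j x - ∑ k, chr F k i j x * pd f k x)

/-- An alternating map on coordinate vectors is continuous. -/
theorem AlternatingMap.continuous_coord {m n : ℕ}
    (ω : AlternatingMap ℝ (Fin n → ℝ) ℝ (Fin m)) : Continuous ω := by
  have h : ∀ v : Fin m → Fin n → ℝ, ω v = ∑ f : Fin m → Fin n,
      (∏ i, v i (f i)) * ω (fun i => Pi.single (f i) (1 : ℝ)) := by
    intro v
    have hv : v = fun i => ∑ a, v i a • (Pi.single a (1 : ℝ) : Fin n → ℝ) := by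
      funext i
      exact pi_eq_sum_univ' (v i)
    have h1 := ω.toMultilinearMap.map_sum
      (g := fun i a => v i a • (Pi.single a (1 : ℝ) : Fin n → ℝ))
    rw [← hv] at h1
    refine h1.trans (Finset.sum_congr rfl fun f _ => ?_)
    exact ω.toMultilinearMap.map_smul_univ (fun i => v i (f i)) _
  rw [show (ω : (Fin m → Fin n → ℝ) → ℝ) = _ from funext h]
  fun_prop

/-- The continuous alternating map underlying an alternating map on coordinate vectors. -/
def AlternatingMap.toContinuousCoord {m n : ℕ}
    (ω : AlternatingMap ℝ (Fin n → ℝ) ℝ (Fin m)) : (Fin n → ℝ) [⋀^Fin m]→L[ℝ] ℝ :=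
  { ω with cont := ω.continuous_coord }

theorem AlternatingMap.contDiff_coord {m n : ℕ} {E : Type*} [NormedAddCommGroup E]
    [NormedSpace ℝ E] {k : WithTop ℕ∞} (ω : AlternatingMap ℝ (Fin n → ℝ) ℝ (Fin m))
    {X : E → Fin m → Fin n → ℝ} (hX : ∀ i a, ContDiff ℝ k (fun y => X y i a)) :
    ContDiff ℝ k (fun y => ω (X y)) :=
  ω.toContinuousCoord.toContinuousMultilinearMap.contDiff.comp
    (contDiff_pi.2 fun i => contDiff_pi.2 fun a => hX i a)

/-- Leibniz rule for an alternating map evaluated along a curve of frames. -/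
theorem AlternatingMap.hasDerivAt_coord {m n : ℕ}
    (ω : AlternatingMap ℝ (Fin n → ℝ) ℝ (Fin m)) {X : ℝ → Fin m → Fin n → ℝ}
    {X' : Fin m → Fin n → ℝ} {t : ℝ}
    (hX : ∀ i a, HasDerivAt (fun s => X s i a) (X' i a) t) :
    HasDerivAt (fun s => ω (X s)) (∑ i, ω (Function.update (X t) i (X' i))) t := by
  have hX' : HasDerivAt X X' t := hasDerivAt_pi.2 fun i => hasDerivAt_pi.2 fun a => hX i a
  have h := (ω.toContinuousCoord.hasFDerivAt (X t)).comp_hasDerivAt t hX'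
  have e : (ω.toContinuousCoord.1.linearDeriv (X t)) X' =
      ∑ i, ω (Function.update (X t) i (X' i)) := by
    simp [ContinuousMultilinearMap.linearDeriv_apply]
    rfl
  rw [e] at h
  exact h

/-- Replacing, one at a time, the vectors of a frame by linear combinations of the frame
yields the trace of the coefficient matrix. -/
theorem AlternatingMap.sum_update_lincomb {m n : ℕ}
    (ω : AlternatingMap ℝ (Fin n → ℝ) ℝ (Fin m)) (X : Fin m → Fin n → ℝ)
    (C : Matrix (Fin m) (Fin m) ℝ) :
    ∑ i, ω (Function.update X i (∑ p, C i p • X p)) = C.trace * ω X := by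
  rw [Matrix.trace, Finset.sum_mul]
  refine Finset.sum_congr rfl fun i _ => ?_
  rw [AlternatingMap.map_update_sum, Finset.sum_eq_single i]
  · rw [AlternatingMap.map_update_smul, Function.update_eq_self]; rfl
  · intro p _ hp
    rw [AlternatingMap.map_update_smul, AlternatingMap.map_update_self _ _ (Ne.symm hp), smul_zero]
  · simp

/-- Leibniz rule for an alternating map along a curve of frames one entry of which
follows a curve of its own. -/
theorem AlternatingMap.hasDerivAt_update {m n : ℕ}
    (ω : AlternatingMap ℝ (Fin n → ℝ) ℝ (Fin m)) {X : ℝ → Fin m → Fin n → ℝ}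
    {X' : Fin m → Fin n → ℝ} {Y : ℝ → Fin n → ℝ} {Y' : Fin n → ℝ} {t : ℝ} (i : Fin m)
    (hX : ∀ i a, HasDerivAt (fun s => X s i a) (X' i a) t)
    (hY : ∀ a, HasDerivAt (fun s => Y s a) (Y' a) t) :
    HasDerivAt (fun s => ω (Function.update (X s) i (Y s)))
      (ω (Function.update (X t) i Y') + ∑ j ∈ univ.erase i,
        ω (Function.update (Function.update (X t) i (Y t)) j (X' j))) t := by
  have h := ω.hasDerivAt_coord (X := fun s => Function.update (X s) i (Y s))
    (X' := Function.update X' i Y') (t := t) (fun j a => by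
      rcases eq_or_ne j i with rfl | hj
      · simpa using hY a
      · simpa [hj] using hX j a)
  rw [← Finset.add_sum_erase _ _ (mem_univ i)] at h
  convert h using 2
  · simp
  · refine Finset.sum_congr rfl fun j hj => ?_
    rw [Function.update_of_ne (Finset.ne_of_mem_erase hj)]

/-- Polarized form of `AlternatingMap.sum_update_lincomb`. -/
theorem AlternatingMap.sum_update_update_lincomb {m n : ℕ}
    (ω : AlternatingMap ℝ (Fin n → ℝ) ℝ (Fin m)) (X E : Fin m → Fin n → ℝ)
    (C : Matrix (Fin m) (Fin m) ℝ) :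
    ∑ i, ∑ j ∈ univ.erase i,
        ω (Function.update (Function.update X i (E i)) j (∑ p, C j p • X p)) =
      C.trace * ∑ i, ω (Function.update X i (E i))
        - ∑ i, ω (Function.update X i (∑ p, C i p • E p)) := by
  have hX : ∀ i a, HasDerivAt (fun s : ℝ => (X + s • E) i a) (E i a) 0 := fun i a => by
    simpa using ((hasDerivAt_id (0 : ℝ)).mul_const (E i a)).const_add (X i a)
  have hY : ∀ i a, HasDerivAt (fun s : ℝ => (∑ p, C i p • (X + s • E) p) a)
      ((∑ p, C i p • E p) a) 0 := fun i a => by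
    simp only [Finset.sum_apply, Pi.smul_apply, smul_eq_mul]
    exact HasDerivAt.fun_sum fun p _ => (hX p a).const_mul (C i p)
  have h1 := HasDerivAt.fun_sum (u := univ) fun i _ =>
    ω.hasDerivAt_update (X := fun s => X + s • E) i hX (hY i)
  have h2 := (ω.hasDerivAt_coord (X := fun s => X + s • E) hX).const_mul C.trace
  rw [show (fun s : ℝ => C.trace * ω (X + s • E)) = _ from
    funext fun s => (ω.sum_update_lincomb (X + s • E) C).symm] at h2
  have h3 := h1.unique h2
  simp only [zero_smul, add_zero, Finset.sum_add_distrib] at h3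
  rw [← h3, add_sub_cancel_left]
  rw [Finset.sum_sigma', Finset.sum_sigma']
  refine Finset.sum_bij' (fun x _ => ⟨x.2, x.1⟩) (fun x _ => ⟨x.2, x.1⟩) ?_ ?_ ?_ ?_ ?_
  · simp [eq_comm]
  · simp [eq_comm]
  · simp
  · simp
  · intro x hx
    have hx' : x.2 ≠ x.1 := by simpa using hx
    rw [Function.update_comm hx']

/-- Contracting two slots of an alternating map with a symmetric tensor gives zero. -/
theorem AlternatingMap.sum_update_update_symm {m n : ℕ} {κ : Type*} [Fintype κ]
    (ω : AlternatingMap ℝ (Fin n → ℝ) ℝ (Fin m)) (X : Fin m → Fin n → ℝ) {i j : Fin m}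
    (hij : i ≠ j) (c : κ → ℝ) (u v : κ → Fin n → ℝ)
    (hS : ∀ α β, ∑ k, c k * (u k α * v k β) = ∑ k, c k * (u k β * v k α)) :
    ∑ k, c k * ω (Function.update (Function.update X i (u k)) j (v k)) = 0 := by
  set b : Fin n → Fin n → ℝ := fun α β =>
    ω (Function.update (Function.update X i (Pi.single α 1)) j (Pi.single β 1)) with hb
  have hanti : ∀ α β, b α β = -b β α := fun α β => by
    have := ω.map_swap (Function.update (Function.update X i (Pi.single β 1)) j (Pi.single α 1)) hij
    refine Eq.trans ?_ this
    refine congrArg ω ?_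
    funext k
    simp only [Function.comp, Equiv.swap_apply_def, Function.update_apply]
    by_cases hi : k = i
    · subst hi; simp [hij]
    · by_cases hj : k = j
      · simp [hj, hij, hij.symm]
      · simp [hi, hj]
  have hexp : ∀ u v : Fin n → ℝ, ω (Function.update (Function.update X i u) j v) =
      ∑ α, ∑ β, u α * v β * b α β := fun u v => by
    conv_lhs => rw [pi_eq_sum_univ' u, pi_eq_sum_univ' v]
    rw [AlternatingMap.map_update_sum, Finset.sum_comm]
    refine Finset.sum_congr rfl fun β _ => ?_
    rw [AlternatingMap.map_update_smul, Function.update_comm hij, AlternatingMap.map_update_sum,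
      smul_eq_mul, Finset.mul_sum]
    refine Finset.sum_congr rfl fun α _ => ?_
    rw [AlternatingMap.map_update_smul, Function.update_comm hij.symm, smul_eq_mul, hb]
    ring
  have key : ∑ k, c k * ω (Function.update (Function.update X i (u k)) j (v k)) =
      ∑ α, ∑ β, (∑ k, c k * (u k α * v k β)) * b α β := by
    simp_rw [hexp, Finset.mul_sum, Finset.sum_mul]
    rw [Finset.sum_comm]
    refine Finset.sum_congr rfl fun α _ => ?_
    rw [Finset.sum_comm]
    exact Finset.sum_congr rfl fun β _ => Finset.sum_congr rfl fun k _ => by ring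
  have hneg : ∑ α, ∑ β, (∑ k, c k * (u k α * v k β)) * b α β =
      -∑ α, ∑ β, (∑ k, c k * (u k α * v k β)) * b α β := by
    conv_lhs => rw [Finset.sum_comm]
    simp_rw [← Finset.sum_neg_distrib]
    refine Finset.sum_congr rfl fun α _ => Finset.sum_congr rfl fun β _ => ?_
    rw [hS β α, hanti β α]
    ring
  rw [key]
  linarith

/-- Entrywise differentiability of a curve of matrices. -/
def Matrix.HasEntryDerivAt {a b : Type*} (M : ℝ → Matrix a b ℝ) (M' : Matrix a b ℝ)
    (t : ℝ) : Prop :=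
  ∀ i j, HasDerivAt (fun s => M s i j) (M' i j) t

namespace Matrix.HasEntryDerivAt

variable {a b c : Type*} {t : ℝ}

theorem unique {M : ℝ → Matrix a b ℝ} {M₁ M₂ : Matrix a b ℝ}
    (h₁ : HasEntryDerivAt M M₁ t) (h₂ : HasEntryDerivAt M M₂ t) : M₁ = M₂ := by
  ext i j
  exact (h₁ i j).unique (h₂ i j)

theorem transpose {M : ℝ → Matrix a b ℝ} {M' : Matrix a b ℝ}
    (h : HasEntryDerivAt M M' t) : HasEntryDerivAt (fun s => (M s)ᵀ) M'ᵀ t :=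
  fun i j => h j i

theorem add {M N : ℝ → Matrix a b ℝ} {M' N' : Matrix a b ℝ}
    (hM : HasEntryDerivAt M M' t) (hN : HasEntryDerivAt N N' t) :
    HasEntryDerivAt (fun s => M s + N s) (M' + N') t :=
  fun i j => (hM i j).add (hN i j)

theorem const (M : Matrix a b ℝ) : HasEntryDerivAt (fun _ => M) 0 t :=
  fun i j => hasDerivAt_const t (M i j)

theorem mul [Fintype b] {M : ℝ → Matrix a b ℝ} {N : ℝ → Matrix b c ℝ} {M' : Matrix a b ℝ}
    {N' : Matrix b c ℝ} (hM : HasEntryDerivAt M M' t) (hN : HasEntryDerivAt N N' t) :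
    HasEntryDerivAt (fun s => M s * N s) (M' * N t + M t * N') t := by
  intro i j
  simp only [Matrix.mul_apply, Matrix.add_apply, ← Finset.sum_add_distrib]
  exact HasDerivAt.fun_sum fun k _ => (hM i k).mul (hN k j)

end Matrix.HasEntryDerivAt

/-- Jacobi formula for the derivative of a determinant. -/
theorem Matrix.HasEntryDerivAt.det {m : ℕ} {g : ℝ → Matrix (Fin m) (Fin m) ℝ}
    {g' : Matrix (Fin m) (Fin m) ℝ} {t : ℝ} (hg : HasEntryDerivAt g g' t)
    (hdet : (g t).det ≠ 0) :
    HasDerivAt (fun s => (g s).det) ((g' * (g t)⁻¹).trace * (g t).det) t := by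
  have h := (Matrix.detRowAlternating (n := Fin m) (R := ℝ)).hasDerivAt_coord hg
  refine h.congr_deriv (Eq.trans (Finset.sum_congr rfl fun i _ => ?_)
    ((Matrix.detRowAlternating (n := Fin m) (R := ℝ)).sum_update_lincomb (g t) (g' * (g t)⁻¹)))
  have hrow : ∑ p, (g' * (g t)⁻¹) i p • g t p = g' i := by
    have e : g' * (g t)⁻¹ * g t = g' := Matrix.nonsing_inv_mul_cancel_right _ _ (Ne.isUnit hdet)
    funext j
    conv_rhs => rw [← e]
    simp [Matrix.mul_apply]
  rw [hrow]

/-- Derivative of the volume density along a curve of frames. -/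
theorem hasDerivAt_sqrt_gram {m n : ℕ} {X : ℝ → Matrix (Fin m) (Fin n) ℝ}
    {X' : Matrix (Fin m) (Fin n) ℝ} {t : ℝ} (hX : Matrix.HasEntryDerivAt X X' t)
    (hdet : 0 < (X t * (X t).transpose).det) :
    HasDerivAt (fun s => √(X s * (X s).transpose).det)
      ((X' * (X t).transpose * (X t * (X t).transpose)⁻¹).trace
        * √(X t * (X t).transpose).det) t := by
  have h := ((hX.mul hX.transpose).det hdet.ne').sqrt hdet.ne'
  convert h using 1
  have e : (X t * X'.transpose * (X t * (X t).transpose)⁻¹).trace =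
      (X' * (X t).transpose * (X t * (X t).transpose)⁻¹).trace := by
    rw [← Matrix.trace_transpose, Matrix.transpose_mul, Matrix.transpose_nonsing_inv,
      Matrix.transpose_mul, Matrix.transpose_mul, Matrix.transpose_transpose,
      Matrix.transpose_transpose, Matrix.trace_mul_comm]
  rw [Matrix.add_mul, Matrix.trace_add, e]
  have h2 := Real.mul_self_sqrt hdet.le
  have h3 : √(X t * (X t).transpose).det ≠ 0 := (Real.sqrt_pos.2 hdet).ne'
  field_simp
  rw [Real.sq_sqrt hdet.le]
  ring

/-- Quotient rule for densities divided by the volume density along a curve of frames. -/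
theorem HasDerivAt.div_sqrt_gram {m n : ℕ} {X : ℝ → Matrix (Fin m) (Fin n) ℝ}
    {X' : Matrix (Fin m) (Fin n) ℝ} {P : ℝ → ℝ} {P' t : ℝ} (hP : HasDerivAt P P' t)
    (hX : Matrix.HasEntryDerivAt X X' t) (hdet : 0 < (X t * (X t).transpose).det) :
    HasDerivAt (fun s => P s / √(X s * (X s).transpose).det)
      ((P' - (X' * (X t).transpose * (X t * (X t).transpose)⁻¹).trace * P t)
        / √(X t * (X t).transpose).det) t := by
  have h3 : √(X t * (X t).transpose).det ≠ 0 := (Real.sqrt_pos.2 hdet).ne'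
  refine (hP.div (hasDerivAt_sqrt_gram hX hdet) h3).congr_deriv ?_
  field_simp

section PartialDerivatives

variable {m : ℕ} {h : (Fin m → ℝ) → ℝ}

theorem contDiff_pd (hh : ContDiff ℝ (⊤ : ℕ∞) h) (i : Fin m) :
    ContDiff ℝ (⊤ : ℕ∞) (pd h i) :=
  (hh.fderiv_right (m := (⊤ : ℕ∞)) (by simp)).clm_apply contDiff_const

theorem hasDerivAt_pd {x : Fin m → ℝ} (hh : DifferentiableAt ℝ h x) (i : Fin m) :
    HasDerivAt (fun s : ℝ => h (x + s • Pi.single i 1)) (pd h i x) 0 :=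
  hh.hasFDerivAt.hasLineDerivAt _

theorem pd_eq_of_hasDerivAt {x : Fin m → ℝ} (hh : DifferentiableAt ℝ h x) {i : Fin m} {v : ℝ}
    (hv : HasDerivAt (fun s : ℝ => h (x + s • Pi.single i 1)) v 0) : pd h i x = v :=
  (hasDerivAt_pd hh i).unique hv

theorem pd_pd_comm (hh : ContDiff ℝ (⊤ : ℕ∞) h) (i j : Fin m) (x : Fin m → ℝ) :
    pd (pd h i) j x = pd (pd h j) i x := by
  have hd : DifferentiableAt ℝ (fderiv ℝ h) x :=
    (hh.fderiv_right (m := (⊤ : ℕ∞)) (by simp)).differentiable (by simp) x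
  have hs : IsSymmSndFDerivAt ℝ h x := hh.contDiffAt.isSymmSndFDerivAt (by
    rw [minSmoothness_of_isRCLikeNormedField]
    exact WithTop.coe_le_coe.2 (le_top : (2 : ℕ∞) ≤ ⊤))
  have key : ∀ i j, pd (pd h i) j x = fderiv ℝ (fderiv ℝ h) x (Pi.single j 1) (Pi.single i 1) := by
    intro i j
    rw [pd, show pd h i = fun y => fderiv ℝ h y (Pi.single i 1) from rfl,
      fderiv_clm_apply hd (differentiableAt_const _)]
    simp
  rw [key, key]
  exact hs _ _

end PartialDerivatives

/-- Rows are the coordinate tangent vectors. -/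
def frameMat {m n : ℕ} (f : (Fin m → ℝ) → (Fin n → ℝ)) (x : Fin m → ℝ) :
    Matrix (Fin m) (Fin n) ℝ :=
  fun i α => Fd f α i x

/-- Rows are the vectors `A_{ki}`, for fixed `k`. -/
def sffMat {m n : ℕ} (f : (Fin m → ℝ) → (Fin n → ℝ)) (k : Fin m) (x : Fin m → ℝ) :
    Matrix (Fin m) (Fin n) ℝ :=
  fun i α => sff f α k i x

/-- The matrix of the Levi-Civita connection in the direction `k`. -/
def chrMat {m n : ℕ} (f : (Fin m → ℝ) → (Fin n → ℝ)) (k : Fin m) (x : Fin m → ℝ) :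
    Matrix (Fin m) (Fin m) ℝ :=
  fun i p => chr f p k i x

section Immersion

variable {m n : ℕ} {f : (Fin m → ℝ) → (Fin n → ℝ)}

theorem gMat_eq_frameMat_mul (f : (Fin m → ℝ) → (Fin n → ℝ)) (x : Fin m → ℝ) :
    gMat f x = frameMat f x * (frameMat f x).transpose := by
  ext i j
  rfl

theorem gMat_transpose (f : (Fin m → ℝ) → (Fin n → ℝ)) (x : Fin m → ℝ) :
    (gMat f x).transpose = gMat f x := by
  rw [gMat_eq_frameMat_mul, Matrix.transpose_mul, Matrix.transpose_transpose]

theorem gInv_comm (f : (Fin m → ℝ) → (Fin n → ℝ)) (i j : Fin m) (x : Fin m → ℝ) :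
    gInv f i j x = gInv f j i x := by
  unfold gInv
  have h := Matrix.transpose_nonsing_inv (gMat f x)
  rw [gMat_transpose] at h
  exact congrFun (congrFun h j) i

theorem contDiff_Fd (hf : ContDiff ℝ (⊤ : ℕ∞) f) (α : Fin n) (i : Fin m) :
    ContDiff ℝ (⊤ : ℕ∞) (Fd f α i) :=
  contDiff_pd (contDiff_pi.1 hf α) i

theorem contDiff_gInd (hf : ContDiff ℝ (⊤ : ℕ∞) f) (i j : Fin m) :
    ContDiff ℝ (⊤ : ℕ∞) (gInd f i j) :=
  ContDiff.sum fun α _ => (contDiff_Fd hf α i).mul (contDiff_Fd hf α j)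

theorem contDiff_det_gMat (hf : ContDiff ℝ (⊤ : ℕ∞) f) :
    ContDiff ℝ (⊤ : ℕ∞) (fun x => (gMat f x).det) :=
  (Matrix.detRowAlternating (n := Fin m) (R := ℝ)).contDiff_coord (contDiff_gInd hf)

theorem contDiff_volDens (hf : ContDiff ℝ (⊤ : ℕ∞) f) (hd : ∀ x, 0 < (gMat f x).det) :
    ContDiff ℝ (⊤ : ℕ∞) (volDens f) :=
  (contDiff_det_gMat hf).sqrt fun x => (hd x).ne'

theorem contDiff_gInv (hf : ContDiff ℝ (⊤ : ℕ∞) f) (hd : ∀ x, 0 < (gMat f x).det)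
    (i j : Fin m) : ContDiff ℝ (⊤ : ℕ∞) (gInv f i j) := by
  have e : gInv f i j = fun x => (gMat f x).det⁻¹ *
      Matrix.detRowAlternating ((gMat f x).updateRow j (Pi.single i 1)) := by
    funext x
    rw [gInv, Matrix.inv_def, Matrix.smul_apply, Matrix.adjugate_apply, Ring.inverse_eq_inv,
      smul_eq_mul]
    rfl
  rw [e]
  refine ((contDiff_det_gMat hf).inv fun x => (hd x).ne').mul
    (Matrix.detRowAlternating.contDiff_coord fun k l => ?_)
  simp only [Matrix.updateRow_apply]
  split_ifs
  · exact contDiff_const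
  · exact contDiff_gInd hf k l

theorem contDiff_chr (hf : ContDiff ℝ (⊤ : ℕ∞) f) (hd : ∀ x, 0 < (gMat f x).det)
    (k i j : Fin m) : ContDiff ℝ (⊤ : ℕ∞) (chr f k i j) :=
  contDiff_const.mul <| ContDiff.sum fun l _ => (contDiff_gInv hf hd k l).mul <|
    ((contDiff_pd (contDiff_gInd hf l j) i).add (contDiff_pd (contDiff_gInd hf l i) j)).sub
      (contDiff_pd (contDiff_gInd hf i j) l)

theorem contDiff_sff (hf : ContDiff ℝ (⊤ : ℕ∞) f) (hd : ∀ x, 0 < (gMat f x).det)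
    (α : Fin n) (i j : Fin m) : ContDiff ℝ (⊤ : ℕ∞) (sff f α i j) :=
  (contDiff_pd (contDiff_Fd hf α j) i).sub <| ContDiff.sum fun k _ =>
    (contDiff_chr hf hd k i j).mul (contDiff_Fd hf α k)

theorem contDiff_mcv (hf : ContDiff ℝ (⊤ : ℕ∞) f) (hd : ∀ x, 0 < (gMat f x).det)
    (α : Fin n) : ContDiff ℝ (⊤ : ℕ∞) (mcv f α) :=
  ContDiff.sum fun i _ => ContDiff.sum fun j _ =>
    (contDiff_gInv hf hd i j).mul (contDiff_sff hf hd α i j)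

theorem pd_Fd_comm (hf : ContDiff ℝ (⊤ : ℕ∞) f) (α : Fin n) (i j : Fin m) (x : Fin m → ℝ) :
    pd (Fd f α j) i x = pd (Fd f α i) j x :=
  pd_pd_comm (contDiff_pi.1 hf α) j i x

theorem pd_gInd (hf : ContDiff ℝ (⊤ : ℕ∞) f) (i j k : Fin m) (x : Fin m → ℝ) :
    pd (gInd f i j) k x =
      ∑ α, (pd (Fd f α i) k x * Fd f α j x + Fd f α i x * pd (Fd f α j) k x) := by
  refine pd_eq_of_hasDerivAt ((contDiff_gInd hf i j).differentiable (by simp) x)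
    (HasDerivAt.fun_sum fun α _ => ?_)
  have h := (hasDerivAt_pd ((contDiff_Fd hf α i).differentiable (by simp) x) k).fun_mul
    (hasDerivAt_pd ((contDiff_Fd hf α j).differentiable (by simp) x) k)
  simp only [zero_smul, add_zero] at h
  exact h

theorem chr_eq (hf : ContDiff ℝ (⊤ : ℕ∞) f) (k i j : Fin m) (x : Fin m → ℝ) :
    chr f k i j x = ∑ l, gInv f k l x * ∑ α, Fd f α l x * pd (Fd f α j) i x := by
  rw [chr, Finset.mul_sum]
  refine Finset.sum_congr rfl fun l _ => ?_
  rw [pd_gInd hf, pd_gInd hf, pd_gInd hf, ← Finset.sum_add_distrib, ← Finset.sum_sub_distrib,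
    mul_left_comm, Finset.mul_sum]
  congr 1
  refine Finset.sum_congr rfl fun α _ => ?_
  rw [pd_Fd_comm hf α i l, pd_Fd_comm hf α j l, pd_Fd_comm hf α j i]
  ring

theorem chr_comm (hf : ContDiff ℝ (⊤ : ℕ∞) f) (k i j : Fin m) (x : Fin m → ℝ) :
    chr f k i j x = chr f k j i x := by
  simp_rw [chr_eq hf, pd_Fd_comm hf _ i j]

theorem sff_comm (hf : ContDiff ℝ (⊤ : ℕ∞) f) (α : Fin n) (i j : Fin m) (x : Fin m → ℝ) :
    sff f α i j x = sff f α j i x := by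
  rw [sff, sff, pd_Fd_comm hf α i j]
  simp_rw [chr_comm hf _ i j]

/-- Gauss formula. -/
theorem hasEntryDerivAt_frameMat (hf : ContDiff ℝ (⊤ : ℕ∞) f) (k : Fin m) (x : Fin m → ℝ) :
    Matrix.HasEntryDerivAt (fun s : ℝ => frameMat f (x + s • Pi.single k 1))
      (sffMat f k x + chrMat f k x * frameMat f x) 0 := by
  intro i α
  refine (hasDerivAt_pd ((contDiff_Fd hf α i).differentiable (by simp) x) k).congr_deriv ?_
  rw [Matrix.add_apply, Matrix.mul_apply]
  exact (sub_add_cancel _ _).symm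

/-- The second fundamental form is normal valued. -/
theorem sffMat_mul_frameMat_transpose (hf : ContDiff ℝ (⊤ : ℕ∞) f)
    (hd : ∀ x, 0 < (gMat f x).det) (k : Fin m) (x : Fin m → ℝ) :
    sffMat f k x * (frameMat f x).transpose = 0 := by
  set D : Matrix (Fin m) (Fin n) ℝ := fun i α => pd (Fd f α i) k x with hD
  have h1 : chrMat f k x = D * (frameMat f x).transpose * (gMat f x)⁻¹ := by
    ext i p
    simp only [chrMat, chr_eq hf, Matrix.mul_apply, hD]
    refine Finset.sum_congr rfl fun l _ => ?_
    rw [gInv_comm, mul_comm]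
    congr 1
    exact Finset.sum_congr rfl fun α _ => mul_comm _ _
  have h2 : sffMat f k x = D - chrMat f k x * frameMat f x := by
    ext i α
    rfl
  rw [h2, h1, Matrix.sub_mul, Matrix.mul_assoc _ (frameMat f x), ← gMat_eq_frameMat_mul,
    Matrix.nonsing_inv_mul_cancel_right _ _ (Ne.isUnit (hd x).ne'), sub_self]

theorem hasEntryDerivAt_gInv (hf : ContDiff ℝ (⊤ : ℕ∞) f) (hd : ∀ x, 0 < (gMat f x).det)
    (k : Fin m) (x : Fin m → ℝ) :
    Matrix.HasEntryDerivAt (fun s : ℝ => (gMat f (x + s • Pi.single k 1))⁻¹)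
      (-((gMat f x)⁻¹ * chrMat f k x + (chrMat f k x).transpose * (gMat f x)⁻¹)) 0 := by
  set K : Matrix (Fin m) (Fin m) ℝ := fun i j => pd (gInv f i j) k x with hK
  have hG : Matrix.HasEntryDerivAt (fun s : ℝ => (gMat f (x + s • Pi.single k 1))⁻¹) K 0 :=
    fun i j => hasDerivAt_pd ((contDiff_gInv hf hd i j).differentiable (by simp) x) k
  have hX := hasEntryDerivAt_frameMat hf k x
  have hu : ∀ y, IsUnit (gMat f y).det := fun y => Ne.isUnit (hd y).ne'
  have hg := hX.mul hX.transpose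
  simp only [← gMat_eq_frameMat_mul, zero_smul, add_zero] at hg
  have h1 := hG.mul hg
  simp only [Matrix.nonsing_inv_mul _ (hu _), zero_smul, add_zero] at h1
  have h2 := h1.unique (Matrix.HasEntryDerivAt.const 1)
  have hBX := sffMat_mul_frameMat_transpose hf hd k x
  have hXB : frameMat f x * (sffMat f k x).transpose = 0 := by
    rw [← Matrix.transpose_transpose (frameMat f x), ← Matrix.transpose_mul, hBX,
      Matrix.transpose_zero]
  have e : (sffMat f k x + chrMat f k x * frameMat f x) * (frameMat f x).transpose +
      frameMat f x * (sffMat f k x + chrMat f k x * frameMat f x).transpose =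
      chrMat f k x * gMat f x + gMat f x * (chrMat f k x).transpose := by
    rw [Matrix.add_mul, hBX, Matrix.transpose_add, Matrix.mul_add, hXB, Matrix.transpose_mul,
      ← Matrix.mul_assoc, Matrix.mul_assoc, ← gMat_eq_frameMat_mul, zero_add, zero_add]
  rw [e] at h2
  have h3 := congrArg (· * (gMat f x)⁻¹) h2
  simp only [Matrix.add_mul, Matrix.mul_add, Matrix.zero_mul] at h3
  rw [Matrix.mul_nonsing_inv_cancel_right _ _ (hu x), ← Matrix.mul_assoc,
    Matrix.mul_nonsing_inv_cancel_right _ _ (hu x), ← Matrix.mul_assoc,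
    Matrix.nonsing_inv_mul _ (hu x), Matrix.one_mul] at h3
  rw [← eq_neg_of_add_eq_zero_left h3]
  exact hG

/-- The vectors `∂_l A_{ki}`, for fixed `l` and `k`. -/
def dsffMat {m n : ℕ} (f : (Fin m → ℝ) → (Fin n → ℝ)) (l k : Fin m) (x : Fin m → ℝ) :
    Matrix (Fin m) (Fin n) ℝ :=
  fun i α => pd (sff f α k i) l x

theorem hasEntryDerivAt_sffMat (hf : ContDiff ℝ (⊤ : ℕ∞) f) (hd : ∀ x, 0 < (gMat f x).det)
    (l k : Fin m) (x : Fin m → ℝ) :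
    Matrix.HasEntryDerivAt (fun s : ℝ => sffMat f k (x + s • Pi.single l 1))
      (dsffMat f l k x) 0 :=
  fun i α => hasDerivAt_pd ((contDiff_sff hf hd α k i).differentiable (by simp) x) l

/-- The vectors `∇_l A_{ki}`, for fixed `l` and `k`. -/
def covAMat {m n : ℕ} (f : (Fin m → ℝ) → (Fin n → ℝ)) (l k : Fin m) (x : Fin m → ℝ) :
    Matrix (Fin m) (Fin n) ℝ :=
  fun i α => covA f l α k i x

theorem covAMat_eq (f : (Fin m → ℝ) → (Fin n → ℝ)) (l k : Fin m) (x : Fin m → ℝ) :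
    covAMat f l k x = dsffMat f l k x - ∑ p, chr f p l k x • sffMat f p x
      - chrMat f l x * sffMat f k x := by
  ext i α
  rw [Matrix.sub_apply, Matrix.sub_apply, Matrix.sum_apply, Matrix.mul_apply]
  rfl

theorem dsffMat_mul_frameMat_transpose (hf : ContDiff ℝ (⊤ : ℕ∞) f)
    (hd : ∀ x, 0 < (gMat f x).det) (l k : Fin m) (x : Fin m → ℝ) :
    dsffMat f l k x * (frameMat f x).transpose = -(sffMat f k x * (sffMat f l x).transpose) := by
  have h1 := (hasEntryDerivAt_sffMat hf hd l k x).mul (hasEntryDerivAt_frameMat hf l x).transpose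
  simp only [sffMat_mul_frameMat_transpose hf hd, zero_smul, add_zero] at h1
  have h2 := h1.unique (Matrix.HasEntryDerivAt.const 0)
  rw [Matrix.transpose_add, Matrix.transpose_mul, Matrix.mul_add, ← Matrix.mul_assoc _ _
    (chrMat f l x).transpose, sffMat_mul_frameMat_transpose hf hd, Matrix.zero_mul, add_zero] at h2
  exact eq_neg_of_add_eq_zero_left h2

theorem covAMat_mul_frameMat_transpose (hf : ContDiff ℝ (⊤ : ℕ∞) f)
    (hd : ∀ x, 0 < (gMat f x).det) (l k : Fin m) (x : Fin m → ℝ) :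
    covAMat f l k x * (frameMat f x).transpose = -(sffMat f k x * (sffMat f l x).transpose) := by
  simp only [covAMat_eq, Matrix.sub_mul, Matrix.mul_assoc, Matrix.sum_mul, Matrix.smul_mul,
    sffMat_mul_frameMat_transpose hf hd, dsffMat_mul_frameMat_transpose hf hd]
  simp

/-- Codazzi equation: `∇_l A_{ik} - ∇_i A_{lk}` is tangential. -/
theorem exists_covAMat_sub (hf : ContDiff ℝ (⊤ : ℕ∞) f) (hd : ∀ x, 0 < (gMat f x).det)
    (l i : Fin m) (x : Fin m → ℝ) : ∃ C : Matrix (Fin m) (Fin m) ℝ,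
      covAMat f l i x - covAMat f i l x = C * frameMat f x := by
  set dΓ : Fin m → Fin m → Matrix (Fin m) (Fin m) ℝ := fun l i k p => pd (chr f p i k) l x
  set D : Fin m → Fin m → Matrix (Fin m) (Fin n) ℝ := fun l i k α => pd (pd (Fd f α k) i) l x
    with hD
  have hsym : D l i = D i l := by
    ext k α
    exact pd_pd_comm (contDiff_Fd hf α k) i l x
  have key : ∀ l i, D l i = dsffMat f l i x + (dΓ l i * frameMat f x +
      chrMat f i x * (sffMat f l x + chrMat f l x * frameMat f x)) := by
    intro l i
    have hΓ : Matrix.HasEntryDerivAt (fun s : ℝ => chrMat f i (x + s • Pi.single l 1))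
        (dΓ l i) 0 := fun k p =>
      hasDerivAt_pd ((contDiff_chr hf hd p i k).differentiable (by simp) x) l
    have h1 := (hasEntryDerivAt_sffMat hf hd l i x).add
      (hΓ.mul (hasEntryDerivAt_frameMat hf l x))
    simp only [zero_smul, add_zero] at h1
    refine Matrix.HasEntryDerivAt.unique (fun k α => ?_) h1
    refine (hasDerivAt_pd ((contDiff_pd (contDiff_Fd hf α k) i).differentiable (by simp) x)
      l).congr_of_eventuallyEq (Filter.Eventually.of_forall fun s => ?_)
    simp only [Matrix.add_apply, Matrix.mul_apply]
    exact sub_add_cancel _ _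
  refine ⟨dΓ i l + chrMat f l x * chrMat f i x - dΓ l i - chrMat f i x * chrMat f l x, ?_⟩
  rw [key, key] at hsym
  have hsum : ∑ p, chr f p l i x • sffMat f p x = ∑ p, chr f p i l x • sffMat f p x := by
    simp_rw [chr_comm hf _ l i]
  rw [covAMat_eq, covAMat_eq, hsum]
  simp only [Matrix.mul_add, Matrix.add_mul, Matrix.sub_mul, ← Matrix.mul_assoc] at hsym ⊢
  have h4 := sub_eq_zero.2 hsym
  rw [← sub_eq_zero, ← h4]
  abel

/-- `g^{kl} ∇_l A_{ki}`, the rough Laplacian of the differential. -/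
def traceCovA {m n : ℕ} (f : (Fin m → ℝ) → (Fin n → ℝ)) (x : Fin m → ℝ) :
    Matrix (Fin m) (Fin n) ℝ :=
  ∑ k, ∑ l, gInv f k l x • covAMat f l k x

/-- The derivatives `∂_i H` of the mean curvature vector. -/
def dmcvMat {m n : ℕ} (f : (Fin m → ℝ) → (Fin n → ℝ)) (x : Fin m → ℝ) :
    Matrix (Fin m) (Fin n) ℝ :=
  fun i α => pd (mcv f α) i x

theorem pd_mcv (hf : ContDiff ℝ (⊤ : ℕ∞) f) (hd : ∀ x, 0 < (gMat f x).det)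
    (α : Fin n) (i : Fin m) (x : Fin m → ℝ) :
    pd (mcv f α) i x = ∑ k, ∑ l, gInv f k l x * covA f i α k l x := by
  have hG := hasEntryDerivAt_gInv hf hd i x
  have h1 : pd (mcv f α) i x = ∑ k, ∑ l,
      (-(∑ p, gInv f k p x * chr f l i p x + ∑ p, chr f k i p x * gInv f p l x) * sff f α k l x
        + gInv f k l x * pd (sff f α k l) i x) := by
    refine pd_eq_of_hasDerivAt ((contDiff_mcv hf hd α).differentiable (by simp) x)
      (HasDerivAt.fun_sum fun k _ => HasDerivAt.fun_sum fun l _ => ?_)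
    have h := (hG k l).fun_mul
      (hasDerivAt_pd ((contDiff_sff hf hd α k l).differentiable (by simp) x) i)
    simp only [zero_smul, add_zero, Matrix.neg_apply, Matrix.add_apply, Matrix.mul_apply] at h
    exact h
  have h2 : ∑ k, ∑ l, (∑ p, gInv f k p x * chr f l i p x) * sff f α k l x =
      ∑ k, ∑ l, gInv f k l x * ∑ p, chr f p i l x * sff f α k p x := by
    refine Finset.sum_congr rfl fun k _ => ?_
    simp_rw [Finset.sum_mul, Finset.mul_sum]
    rw [Finset.sum_comm]
    exact Finset.sum_congr rfl fun l _ => Finset.sum_congr rfl fun p _ => by ring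
  have h3 : ∑ k, ∑ l, (∑ p, chr f k i p x * gInv f p l x) * sff f α k l x =
      ∑ k, ∑ l, gInv f k l x * ∑ p, chr f p i k x * sff f α p l x := by
    rw [Finset.sum_comm]
    conv_rhs => rw [Finset.sum_comm]
    refine Finset.sum_congr rfl fun l _ => ?_
    simp_rw [Finset.sum_mul, Finset.mul_sum]
    rw [Finset.sum_comm]
    exact Finset.sum_congr rfl fun k _ => Finset.sum_congr rfl fun p _ => by ring
  rw [h1]
  simp only [covA, mul_sub, Finset.sum_sub_distrib, Finset.sum_add_distrib, neg_mul, add_mul,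
    Finset.sum_neg_distrib, h2, h3]
  ring

theorem exists_traceCovA_sub (hf : ContDiff ℝ (⊤ : ℕ∞) f) (hd : ∀ x, 0 < (gMat f x).det)
    (x : Fin m → ℝ) : ∃ C : Matrix (Fin m) (Fin m) ℝ,
      traceCovA f x - dmcvMat f x = C * frameMat f x := by
  choose C hC using fun l i => exists_covAMat_sub hf hd l i x
  have hsymA : ∀ l α i k, covA f l α i k x = covA f l α k i x := fun l α i k => by
    have h1 : (fun y => sff f α i k y) = fun y => sff f α k i y :=
      funext fun y => sff_comm hf α i k y
    have h2 : ∀ i k, ∑ p, chr f p l i x * sff f α p k x = ∑ p, chr f p l i x * sff f α k p x :=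
      fun i k => Finset.sum_congr rfl fun p _ => by rw [sff_comm hf α p k]
    rw [covA, covA, h1, h2 i k, h2 k i]
    ring
  refine ⟨Matrix.of fun i p => ∑ k, ∑ l, gInv f k l x * C l i k p, ?_⟩
  ext i α
  have hC' : ∀ k l, covA f l α k i x - covA f i α k l x = ∑ p, C l i k p * Fd f α p x := by
    intro k l
    rw [hsymA l α k i, hsymA i α k l]
    exact congrFun (congrFun (hC l i) k) α
  have hL : (traceCovA f x - dmcvMat f x) i α =
      ∑ k, ∑ l, gInv f k l x * (covA f l α k i x - covA f i α k l x) := by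
    simp only [Matrix.sub_apply, traceCovA, Matrix.sum_apply, Matrix.smul_apply, smul_eq_mul,
      mul_sub, Finset.sum_sub_distrib, ← pd_mcv hf hd]
    rfl
  simp_rw [hL, Matrix.mul_apply, Matrix.of_apply, hC', Finset.sum_mul, Finset.mul_sum]
  conv_rhs => rw [Finset.sum_comm]
  refine Finset.sum_congr rfl fun k _ => ?_
  conv_rhs => rw [Finset.sum_comm]
  exact Finset.sum_congr rfl fun l _ => Finset.sum_congr rfl fun p _ => (mul_assoc _ _ _).symm

theorem trace_traceCovA (hf : ContDiff ℝ (⊤ : ℕ∞) f) (hd : ∀ x, 0 < (gMat f x).det)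
    (x : Fin m → ℝ) :
    (traceCovA f x * (frameMat f x).transpose * (gMat f x)⁻¹).trace = -normA2 f x := by
  simp only [traceCovA, Matrix.sum_mul, Matrix.smul_mul, covAMat_mul_frameMat_transpose hf hd,
    Matrix.trace_sum, Matrix.trace_smul, Matrix.neg_mul, Matrix.trace_neg, smul_eq_mul, mul_neg,
    Finset.sum_neg_distrib, normA2]
  congr 1
  have e : ∀ k l, (sffMat f k x * (sffMat f l x).transpose * (gMat f x)⁻¹).trace =
      ∑ α, ∑ i, ∑ j, gInv f i j x * (sff f α k i x * sff f α l j x) := by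
    intro k l
    simp only [Matrix.trace, Matrix.diag_apply, Matrix.mul_apply, Finset.sum_mul]
    conv_rhs => rw [Finset.sum_comm]
    refine Finset.sum_congr rfl fun i _ => ?_
    conv_rhs => rw [Finset.sum_comm]
    refine Finset.sum_congr rfl fun j _ => Finset.sum_congr rfl fun α _ => ?_
    rw [gInv_comm, mul_comm]
    rfl
  simp_rw [e, Finset.mul_sum]
  conv_rhs => rw [Finset.sum_comm]
  refine Finset.sum_congr rfl fun k _ => ?_
  have e2 : ∀ l, ∑ α, ∑ i, ∑ j, gInv f k l x * (gInv f i j x * (sff f α k i x * sff f α l j x)) =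
      ∑ α, ∑ i, ∑ j, gInv f k l x * gInv f i j x * sff f α k i x * sff f α l j x := fun l =>
    Finset.sum_congr rfl fun α _ => Finset.sum_congr rfl fun i _ =>
      Finset.sum_congr rfl fun j _ => by ring
  simp_rw [e2]
  rw [Finset.sum_comm]
  refine Finset.sum_congr rfl fun α _ => ?_
  rw [Finset.sum_comm]

theorem sum_mcv_mul_Fd (hf : ContDiff ℝ (⊤ : ℕ∞) f) (hd : ∀ x, 0 < (gMat f x).det)
    (q : Fin m) (x : Fin m → ℝ) : ∑ α, mcv f α x * Fd f α q x = 0 := by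
  have h0 : ∀ k l, ∑ α, sff f α k l x * Fd f α q x = 0 := fun k l =>
    congrFun (congrFun (sffMat_mul_frameMat_transpose hf hd k x) l) q
  simp only [mcv, Finset.sum_mul, mul_assoc]
  rw [Finset.sum_comm]
  refine Finset.sum_eq_zero fun k _ => ?_
  rw [Finset.sum_comm]
  refine Finset.sum_eq_zero fun l _ => ?_
  rw [← Finset.mul_sum, h0, mul_zero]

theorem trace_dmcvMat (hf : ContDiff ℝ (⊤ : ℕ∞) f) (hd : ∀ x, 0 < (gMat f x).det)
    (x : Fin m → ℝ) :
    (dmcvMat f x * (frameMat f x).transpose * (gMat f x)⁻¹).trace = -normH2 f x := by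
  have e : ∀ i q, (dmcvMat f x * (frameMat f x).transpose) i q =
      -∑ α, mcv f α x * sff f α i q x := by
    intro i q
    have h1 := HasDerivAt.fun_sum (u := univ) fun α _ =>
      (hasDerivAt_pd ((contDiff_mcv hf hd α).differentiable (by simp) x) i).fun_mul
      (hasEntryDerivAt_frameMat hf i x q α)
    simp only [frameMat] at h1
    simp only [sum_mcv_mul_Fd hf hd, zero_smul, add_zero] at h1
    have h2 := h1.unique (hasDerivAt_const (0 : ℝ) (0 : ℝ))
    have h3 : ∑ α, mcv f α x * (chrMat f i x * frameMat f x) q α = 0 := by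
      simp only [Matrix.mul_apply, Finset.mul_sum]
      rw [Finset.sum_comm]
      refine Finset.sum_eq_zero fun p _ => ?_
      rw [← mul_zero (chrMat f i x q p), ← sum_mcv_mul_Fd hf hd p x, Finset.mul_sum]
      exact Finset.sum_congr rfl fun α _ => mul_left_comm _ _ _
    rw [Finset.sum_add_distrib] at h2
    have h4 : ∑ α, mcv f α x * (sffMat f i x + chrMat f i x * frameMat f x) q α =
        ∑ α, mcv f α x * sff f α i q x := by
      simp only [Matrix.add_apply, mul_add, Finset.sum_add_distrib, h3, add_zero]
      rfl
    refine eq_neg_of_add_eq_zero_left ?_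
    rw [← h4]
    exact h2
  simp only [Matrix.trace, Matrix.diag_apply]
  have e2 : ∀ i, (dmcvMat f x * (frameMat f x).transpose * (gMat f x)⁻¹) i i =
      -∑ α, ∑ q, mcv f α x * (gInv f i q x * sff f α i q x) := by
    intro i
    rw [Matrix.mul_apply]
    simp only [e, neg_mul, Finset.sum_neg_distrib, Finset.sum_mul]
    rw [Finset.sum_comm]
    congr 1
    refine Finset.sum_congr rfl fun α _ => Finset.sum_congr rfl fun q _ => ?_
    rw [gInv_comm, mul_assoc, mul_comm (sff f α i q x)]
    rfl
  simp_rw [e2, Finset.sum_neg_distrib]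
  rw [Finset.sum_comm, normH2]
  congr 1
  refine Finset.sum_congr rfl fun α _ => ?_
  rw [sq]
  simp_rw [← Finset.mul_sum]
  rfl

theorem norP_eq (f : (Fin m → ℝ) → (Fin n → ℝ)) (α β : Fin n) (x : Fin m → ℝ) :
    norP f α β x = ((1 : Matrix (Fin n) (Fin n) ℝ)
      - (frameMat f x).transpose * (gMat f x)⁻¹ * frameMat f x) α β := by
  rw [Matrix.sub_apply, Matrix.one_apply, norP, tanP]
  congr 1
  simp only [Matrix.mul_apply, Finset.sum_mul]
  rw [Finset.sum_comm]
  refine Finset.sum_congr rfl fun j _ => Finset.sum_congr rfl fun i _ => ?_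
  rw [mul_comm (gInv f i j x)]
  rfl

theorem dnorP_eq (hf : ContDiff ℝ (⊤ : ℕ∞) f) (hd : ∀ x, 0 < (gMat f x).det)
    (k : Fin m) (α β : Fin n) (x : Fin m → ℝ) :
    dnorP f k α β x = (-((sffMat f k x).transpose * (gMat f x)⁻¹ * frameMat f x
      + (frameMat f x).transpose * (gMat f x)⁻¹ * sffMat f k x)) α β := by
  have hX := hasEntryDerivAt_frameMat hf k x
  have h1 := ((hX.transpose.mul (hasEntryDerivAt_gInv hf hd k x)).mul hX) α β
  have h2 := (hasDerivAt_const (0 : ℝ) ((1 : Matrix (Fin n) (Fin n) ℝ) α β)).fun_sub h1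
  have hdiff : DifferentiableAt ℝ (fun y => norP f α β y) x := by
    have : ContDiff ℝ (⊤ : ℕ∞) (fun y => norP f α β y) :=
      contDiff_const.sub <| ContDiff.sum fun i _ => ContDiff.sum fun j _ =>
        ((contDiff_gInv hf hd i j).mul (contDiff_Fd hf α i)).mul (contDiff_Fd hf β j)
    exact this.differentiable (by simp) x
  refine pd_eq_of_hasDerivAt hdiff ?_
  simp only [norP_eq, Matrix.sub_apply]
  refine h2.congr_deriv ?_
  simp only [zero_smul, add_zero, zero_sub]
  rw [Matrix.neg_apply]
  congr 1
  refine congrFun (congrFun ?_ α) β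
  simp only [Matrix.transpose_add, Matrix.transpose_mul, Matrix.add_mul, Matrix.mul_add,
    Matrix.mul_neg, Matrix.neg_mul, ← Matrix.mul_assoc]
  abel

/-- Ricci equation. -/
theorem normCurv_eq (hf : ContDiff ℝ (⊤ : ℕ∞) f) (hd : ∀ x, 0 < (gMat f x).det)
    (α β : Fin n) (i j : Fin m) (x : Fin m → ℝ) :
    normCurv f α β i j x = ((sffMat f i x).transpose * (gMat f x)⁻¹ * sffMat f j x
      - (sffMat f j x).transpose * (gMat f x)⁻¹ * sffMat f i x) α β := by
  set X := frameMat f x with hXdef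
  set G := (gMat f x)⁻¹ with hG
  set B := fun k => sffMat f k x with hB
  set N : Matrix (Fin n) (Fin n) ℝ := 1 - X.transpose * G * X with hN
  set P : Fin m → Matrix (Fin n) (Fin n) ℝ := fun k =>
    -((B k).transpose * G * X + X.transpose * G * B k) with hP
  have hu : IsUnit (gMat f x).det := Ne.isUnit (hd x).ne'
  have hXX : X * X.transpose = gMat f x := (gMat_eq_frameMat_mul f x).symm
  have hBX : ∀ k, B k * X.transpose = 0 := fun k => sffMat_mul_frameMat_transpose hf hd k x
  have hXB : ∀ k, X * (B k).transpose = 0 := fun k => by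
    rw [← Matrix.transpose_transpose X, ← Matrix.transpose_mul, hBX, Matrix.transpose_zero]
  have hNX : N * X.transpose = 0 := by
    rw [hN, Matrix.sub_mul, Matrix.one_mul, Matrix.mul_assoc, hXX, Matrix.mul_assoc,
      Matrix.nonsing_inv_mul _ hu, Matrix.mul_one, sub_self]
  have hXN : X * N = 0 := by
    rw [hN, Matrix.mul_sub, Matrix.mul_one, ← Matrix.mul_assoc, ← Matrix.mul_assoc, hXX,
      Matrix.mul_nonsing_inv _ hu, Matrix.one_mul, sub_self]
  have hBN : ∀ k, B k * N = B k := fun k => by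
    rw [hN, Matrix.mul_sub, Matrix.mul_one, ← Matrix.mul_assoc, ← Matrix.mul_assoc, hBX,
      Matrix.zero_mul, Matrix.zero_mul, sub_zero]
  have hNB : ∀ k, N * (B k).transpose = (B k).transpose := fun k => by
    rw [hN, Matrix.sub_mul, Matrix.one_mul, Matrix.mul_assoc, hXB, Matrix.mul_zero, sub_zero]
  have hNP : ∀ k, N * P k = -((B k).transpose * G * X) := fun k => by
    simp only [hP, Matrix.mul_neg, Matrix.mul_add, ← Matrix.mul_assoc, hNB, hNX,
      Matrix.zero_mul, add_zero]
  have hPN : ∀ k, P k * N = -(X.transpose * G * B k) := fun k => by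
    simp only [hP, Matrix.neg_mul, Matrix.add_mul, Matrix.mul_assoc, hXN, hBN,
      Matrix.mul_zero, zero_add]
  have hprod : ∀ k l, N * (P k * P l) * N = (B k).transpose * G * B l := fun k l => by
    rw [← Matrix.mul_assoc, Matrix.mul_assoc, hNP, hPN, Matrix.neg_mul, Matrix.mul_neg, neg_neg,
      Matrix.mul_assoc X.transpose, Matrix.mul_assoc, ← Matrix.mul_assoc X, hXX,
      ← Matrix.mul_assoc (gMat f x), Matrix.mul_nonsing_inv _ hu, Matrix.one_mul]
  have hn : ∀ a b, norP f a b x = N a b := fun a b => norP_eq f a b x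
  have hp : ∀ k a b, dnorP f k a b x = P k a b := fun k a b => dnorP_eq hf hd k a b x
  have hexp : ∀ M : Matrix (Fin n) (Fin n) ℝ, (N * M * N) α β =
      ∑ γ, ∑ δ, N α γ * M γ δ * N δ β := fun M => by
    rw [Matrix.mul_apply, Finset.sum_comm]
    exact Finset.sum_congr rfl fun δ _ => by rw [Matrix.mul_apply, Finset.sum_mul]
  rw [Matrix.sub_apply, ← hprod, ← hprod, hexp, hexp, ← Finset.sum_sub_distrib]
  simp only [normCurv, hn, hp]
  refine Finset.sum_congr rfl fun γ _ => ?_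
  rw [Finset.sum_comm, ← Finset.sum_sub_distrib]
  refine Finset.sum_congr rfl fun ε _ => ?_
  rw [Matrix.mul_apply, Matrix.mul_apply, ← sub_mul, ← mul_sub, ← Finset.sum_sub_distrib,
    Finset.mul_sum, Finset.sum_mul]

/-- If the normal bundle is flat, the shape operators commute. -/
theorem sum_sff_mul_sff_symm (hf : ContDiff ℝ (⊤ : ℕ∞) f) (hd : ∀ x, 0 < (gMat f x).det)
    {x : Fin m → ℝ} (hflat : ∀ α β i j, normCurv f α β i j x = 0) (i j : Fin m) (α β : Fin n) :
    ∑ k : Fin m × Fin m, gInv f k.1 k.2 x * (sff f α k.1 i x * sff f β k.2 j x) =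
      ∑ k : Fin m × Fin m, gInv f k.1 k.2 x * (sff f β k.1 i x * sff f α k.2 j x) := by
  have e : ∀ α β, ∑ k : Fin m × Fin m, gInv f k.1 k.2 x * (sff f α k.1 i x * sff f β k.2 j x) =
      ((sffMat f i x).transpose * (gMat f x)⁻¹ * sffMat f j x) α β := by
    intro α β
    rw [Fintype.sum_prod_type, Finset.sum_comm]
    simp only [Matrix.mul_apply, Finset.sum_mul]
    refine Finset.sum_congr rfl fun l _ => Finset.sum_congr rfl fun k _ => ?_
    rw [sff_comm hf α k i, sff_comm hf β l j, ← mul_assoc, mul_comm (gInv f k l x)]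
    rfl
  have h1 := hflat α β i j
  rw [normCurv_eq hf hd, Matrix.sub_apply, sub_eq_zero] at h1
  rw [e, e, h1]
  have h2 : ((sffMat f j x).transpose * (gMat f x)⁻¹ * sffMat f i x).transpose =
      (sffMat f i x).transpose * (gMat f x)⁻¹ * sffMat f j x := by
    rw [Matrix.transpose_mul, Matrix.transpose_mul, Matrix.transpose_transpose,
      Matrix.transpose_nonsing_inv, gMat_transpose, Matrix.mul_assoc]
  rw [← h2]
  rfl

theorem mul_row_eq_sum {m n : ℕ} (C : Matrix (Fin m) (Fin m) ℝ) (X : Matrix (Fin m) (Fin n) ℝ)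
    (i : Fin m) : (C * X).row i = ∑ p, C i p • X.row p := by
  funext a
  rw [Matrix.row_apply, Matrix.mul_apply, Finset.sum_apply]
  rfl

theorem volDens_eq (f : (Fin m → ℝ) → (Fin n → ℝ)) (x : Fin m → ℝ) :
    volDens f x = √(frameMat f x * (frameMat f x).transpose).det := by
  rw [volDens, gMat_eq_frameMat_mul]

theorem trace_gauss (hf : ContDiff ℝ (⊤ : ℕ∞) f) (hd : ∀ x, 0 < (gMat f x).det)
    (k : Fin m) (x : Fin m → ℝ) :
    ((sffMat f k x + chrMat f k x * frameMat f x) * (frameMat f x).transpose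
      * (gMat f x)⁻¹).trace = (chrMat f k x).trace := by
  rw [Matrix.add_mul, sffMat_mul_frameMat_transpose hf hd, zero_add, Matrix.mul_assoc (chrMat f k x),
    ← gMat_eq_frameMat_mul, Matrix.mul_nonsing_inv_cancel_right _ _ (Ne.isUnit (hd x).ne')]

/-- Leibniz rule for densities divided by the volume density. -/
theorem pd_div_volDens (hf : ContDiff ℝ (⊤ : ℕ∞) f) (hd : ∀ x, 0 < (gMat f x).det)
    {P : (Fin m → ℝ) → ℝ} {x : Fin m → ℝ} {k : Fin m} {P' : ℝ} (hP : DifferentiableAt ℝ P x)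
    (hP' : HasDerivAt (fun s : ℝ => P (x + s • Pi.single k 1)) P' 0) :
    pd (fun y => P y / volDens f y) k x =
      (P' - (chrMat f k x).trace * P x) / volDens f x := by
  have hv : volDens f x ≠ 0 := (Real.sqrt_pos.2 (hd x)).ne'
  have hdiff : DifferentiableAt ℝ (fun y => P y / volDens f y) x := by
    simpa only [div_eq_mul_inv] using
      hP.fun_mul (((contDiff_volDens hf hd).differentiable (by simp) x).fun_inv hv)
  refine pd_eq_of_hasDerivAt hdiff ?_
  have h := hP'.div_sqrt_gram (hasEntryDerivAt_frameMat hf k x)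
    (by simpa [← gMat_eq_frameMat_mul] using hd x)
  simp only [zero_smul, add_zero, ← volDens_eq] at h
  rwa [← gMat_eq_frameMat_mul, trace_gauss hf hd] at h

theorem contDiff_update_sff (hf : ContDiff ℝ (⊤ : ℕ∞) f) (hd : ∀ x, 0 < (gMat f x).det)
    (ω : AlternatingMap ℝ (Fin n → ℝ) ℝ (Fin m)) (k i : Fin m) :
    ContDiff ℝ (⊤ : ℕ∞)
      (fun y => ω (Function.update (frameMat f y).row i ((sffMat f k y).row i))) := by
  refine ω.contDiff_coord fun j a => ?_
  rcases eq_or_ne j i with rfl | hj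
  · simpa using! contDiff_sff hf hd a k j
  · simpa [hj] using! contDiff_Fd hf a j

theorem pd_pullback_div_volDens (hf : ContDiff ℝ (⊤ : ℕ∞) f) (hd : ∀ x, 0 < (gMat f x).det)
    (ω : AlternatingMap ℝ (Fin n → ℝ) ℝ (Fin m)) (k : Fin m) (x : Fin m → ℝ) :
    pd (fun y => ω (frameMat f y).row / volDens f y) k x =
      (∑ i, ω (Function.update (frameMat f x).row i ((sffMat f k x).row i))) / volDens f x := by
  have hP := ω.hasDerivAt_coord (X := fun s : ℝ => (frameMat f (x + s • Pi.single k 1)).row)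
    (X' := (sffMat f k x + chrMat f k x * frameMat f x).row) (hasEntryDerivAt_frameMat hf k x)
  have hdiff : ContDiff ℝ (⊤ : ℕ∞) (fun y => ω (frameMat f y).row) :=
    ω.contDiff_coord fun i a => contDiff_Fd hf a i
  rw [pd_div_volDens hf hd (hdiff.differentiable (by simp) x) hP]
  congr 1
  have hrow : ∀ i, (sffMat f k x + chrMat f k x * frameMat f x).row i =
      (sffMat f k x).row i + ∑ p, chrMat f k x i p • (frameMat f x).row p := fun i => by
    rw [← mul_row_eq_sum]
    rfl
  simp only [zero_smul, add_zero, hrow, AlternatingMap.map_update_add, Finset.sum_add_distrib,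
    ω.sum_update_lincomb]
  ring

theorem pd_pd_pullback_div_volDens (hf : ContDiff ℝ (⊤ : ℕ∞) f)
    (hd : ∀ x, 0 < (gMat f x).det) (ω : AlternatingMap ℝ (Fin n → ℝ) ℝ (Fin m)) (k l : Fin m)
    (x : Fin m → ℝ) :
    pd (fun y => pd (fun y => ω (frameMat f y).row / volDens f y) k y) l x =
      (∑ i, ω (Function.update (frameMat f x).row i ((dsffMat f l k x).row i))
        - ∑ i, ω (Function.update (frameMat f x).row i (∑ p, chrMat f l x i p • (sffMat f k x).row p))
        + ∑ i, ∑ j ∈ univ.erase i, ω (Function.update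
            (Function.update (frameMat f x).row i ((sffMat f k x).row i)) j ((sffMat f l x).row j)))
        / volDens f x := by
  simp_rw [pd_pullback_div_volDens hf hd ω k]
  have hP := HasDerivAt.fun_sum (u := univ) fun i _ =>
    ω.hasDerivAt_update (X := fun s : ℝ => (frameMat f (x + s • Pi.single l 1)).row)
      (X' := (sffMat f l x + chrMat f l x * frameMat f x).row)
      (Y := fun s : ℝ => (sffMat f k (x + s • Pi.single l 1)).row i)
      (Y' := (dsffMat f l k x).row i) i (hasEntryDerivAt_frameMat hf l x)
      (fun a => hasEntryDerivAt_sffMat hf hd l k x i a)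
  have hdiff : ContDiff ℝ (⊤ : ℕ∞) (fun y => ∑ i, ω (Function.update (frameMat f y).row i
      ((sffMat f k y).row i))) := ContDiff.sum fun i _ => contDiff_update_sff hf hd ω k i
  rw [pd_div_volDens hf hd (hdiff.differentiable (by simp) x) hP]
  congr 1
  have hrow : ∀ i, (sffMat f l x + chrMat f l x * frameMat f x).row i =
      (sffMat f l x).row i + ∑ p, chrMat f l x i p • (frameMat f x).row p := fun i => by
    rw [← mul_row_eq_sum]
    rfl
  simp only [zero_smul, add_zero, hrow, AlternatingMap.map_update_add, Finset.sum_add_distrib,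
    ω.sum_update_update_lincomb]
  ring

/-- Laplacian of the density ratio of a parallel form, for flat normal bundle. -/
theorem lapBel_pullback_div_volDens (hf : ContDiff ℝ (⊤ : ℕ∞) f)
    (hd : ∀ x, 0 < (gMat f x).det) {x : Fin m → ℝ}
    (hflat : ∀ α β i j, normCurv f α β i j x = 0)
    (ω : AlternatingMap ℝ (Fin n → ℝ) ℝ (Fin m)) :
    lapBel f (fun y => ω (frameMat f y).row / volDens f y) x =
      (∑ i, ω (Function.update (frameMat f x).row i ((traceCovA f x).row i))) / volDens f x := by
  have hcov : ∀ k l i, ω (Function.update (frameMat f x).row i ((covAMat f l k x).row i)) =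
      ω (Function.update (frameMat f x).row i ((dsffMat f l k x).row i))
      - ω (Function.update (frameMat f x).row i (∑ p, chrMat f l x i p • (sffMat f k x).row p))
      - ∑ p, chr f p k l x * ω (Function.update (frameMat f x).row i ((sffMat f p x).row i)) := by
    intro k l i
    have e : (covAMat f l k x).row i = (dsffMat f l k x).row i - ∑ p, chr f p k l x • (sffMat f p x).row i
        - ∑ p, chrMat f l x i p • (sffMat f k x).row p := by
      rw [covAMat_eq, ← mul_row_eq_sum]
      simp_rw [chr_comm hf _ k l]
      funext a
      simp only [Matrix.row_apply, Pi.sub_apply, Matrix.sub_apply, Matrix.sum_apply, Finset.sum_apply,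
        Matrix.smul_apply, Pi.smul_apply]
    rw [e, AlternatingMap.map_update_sub, AlternatingMap.map_update_sub,
      AlternatingMap.map_update_sum]
    simp only [AlternatingMap.map_update_smul, smul_eq_mul]
    ring
  have htr : ∀ i, ω (Function.update (frameMat f x).row i ((traceCovA f x).row i)) =
      ∑ k, ∑ l, gInv f k l x * ω (Function.update (frameMat f x).row i ((covAMat f l k x).row i)) := by
    intro i
    have e : (traceCovA f x).row i = ∑ k, ∑ l, gInv f k l x • (covAMat f l k x).row i := by
      funext a
      simp only [traceCovA, Matrix.row_apply, Matrix.sum_apply, Finset.sum_apply,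
        Matrix.smul_apply, Pi.smul_apply]
    simp only [e, AlternatingMap.map_update_sum, AlternatingMap.map_update_smul, smul_eq_mul]
  have hzero : ∑ k, ∑ l, gInv f k l x * ∑ i, ∑ j ∈ univ.erase i, ω (Function.update
      (Function.update (frameMat f x).row i ((sffMat f k x).row i)) j ((sffMat f l x).row j)) = 0 := by
    rw [← Fintype.sum_prod_type' (f := fun k l => gInv f k l x * ∑ i, ∑ j ∈ univ.erase i,
      ω (Function.update (Function.update (frameMat f x).row i ((sffMat f k x).row i)) j
        ((sffMat f l x).row j)))]
    simp_rw [Finset.mul_sum]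
    rw [Finset.sum_comm]
    refine Finset.sum_eq_zero fun i _ => ?_
    rw [Finset.sum_comm]
    refine Finset.sum_eq_zero fun j hj => ?_
    exact ω.sum_update_update_symm _ (Finset.ne_of_mem_erase hj).symm
      (fun k : Fin m × Fin m => gInv f k.1 k.2 x) (fun k => (sffMat f k.1 x).row i)
      (fun k => (sffMat f k.2 x).row j) (sum_sff_mul_sff_symm hf hd hflat i j)
  have hterm : ∀ k l, pd (fun y => pd (fun y => ω (frameMat f y).row / volDens f y) k y) l x
      - ∑ p, chr f p k l x * pd (fun y => ω (frameMat f y).row / volDens f y) p x =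
      (∑ i, ω (Function.update (frameMat f x).row i ((covAMat f l k x).row i))
        + ∑ i, ∑ j ∈ univ.erase i, ω (Function.update
            (Function.update (frameMat f x).row i ((sffMat f k x).row i)) j ((sffMat f l x).row j)))
        / volDens f x := by
    intro k l
    rw [pd_pd_pullback_div_volDens hf hd]
    simp_rw [pd_pullback_div_volDens hf hd, hcov, ← mul_div_assoc]
    rw [← Finset.sum_div, ← sub_div]
    congr 1
    rw [Finset.sum_sub_distrib, Finset.sum_sub_distrib, Finset.sum_comm (γ := Fin m) (α := Fin m)
      (s := univ) (t := univ) (f := fun i p => chr f p k l x *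
        ω (Function.update (frameMat f x).row i ((sffMat f p x).row i)))]
    simp_rw [← Finset.mul_sum]
    ring
  rw [lapBel]
  simp_rw [hterm, mul_div_assoc', ← Finset.sum_div]
  congr 1
  simp only [mul_add, Finset.sum_add_distrib, hzero, add_zero, htr]
  simp_rw [Finset.mul_sum]
  conv_rhs => rw [Finset.sum_comm]
  exact Finset.sum_congr rfl fun k _ => Finset.sum_comm

theorem sum_update_traceCovA (hf : ContDiff ℝ (⊤ : ℕ∞) f) (hd : ∀ x, 0 < (gMat f x).det)
    (ω : AlternatingMap ℝ (Fin n → ℝ) ℝ (Fin m)) (x : Fin m → ℝ) :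
    ∑ i, ω (Function.update (frameMat f x).row i ((traceCovA f x).row i)) =
      ∑ i, ω (Function.update (frameMat f x).row i ((dmcvMat f x).row i))
        + (normH2 f x - normA2 f x) * ω (frameMat f x).row := by
  obtain ⟨C, hC⟩ := exists_traceCovA_sub hf hd x
  have htr : C.trace = normH2 f x - normA2 f x := by
    have h1 := congrArg (fun M => (M * (frameMat f x).transpose * (gMat f x)⁻¹).trace) hC
    simp only [Matrix.sub_mul, Matrix.trace_sub, trace_traceCovA hf hd, trace_dmcvMat hf hd] at h1
    rw [Matrix.mul_assoc C, ← gMat_eq_frameMat_mul,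
      Matrix.mul_nonsing_inv_cancel_right _ _ (Ne.isUnit (hd x).ne')] at h1
    rw [← h1]
    ring
  have hrow : ∀ i, (traceCovA f x).row i = (dmcvMat f x).row i + ∑ p, C i p • (frameMat f x).row p := by
    intro i
    rw [← mul_row_eq_sum, ← hC]
    funext a
    rw [Pi.add_apply, Matrix.row_apply, Matrix.row_apply, Matrix.row_apply, Matrix.sub_apply]
    ring
  simp only [hrow, AlternatingMap.map_update_add, Finset.sum_add_distrib, ω.sum_update_lincomb,
    htr]

end Immersion

/-- Under mean curvature flow the coordinate tangent vectors evolve by `∂_i H`. -/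
theorem hasDerivAt_Fd_of_flow {m n : ℕ} {F : ℝ → (Fin m → ℝ) → (Fin n → ℝ)} {t : ℝ}
    (hF : ContDiff ℝ (⊤ : ℕ∞) (fun p : ℝ × (Fin m → ℝ) => F p.1 p.2))
    (hMCF : ∀ x α, deriv (fun s => F s x α) t = mcv (F t) α x)
    (x : Fin m → ℝ) (α : Fin n) (i : Fin m) :
    HasDerivAt (fun s => Fd (F s) α i x) (pd (mcv (F t) α) i x) t := by
  set Φ : ℝ × (Fin m → ℝ) → ℝ := fun p => F p.1 p.2 α with hΦ
  have hΦs : ContDiff ℝ (⊤ : ℕ∞) Φ := contDiff_pi.1 hF α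
  have hΦd : ∀ p, HasFDerivAt Φ (fderiv ℝ Φ p) p := fun p =>
    (hΦs.differentiable (by simp) p).hasFDerivAt
  have hd2 : ∀ p, HasFDerivAt (fderiv ℝ Φ) (fderiv ℝ (fderiv ℝ Φ) p) p := fun p =>
    ((hΦs.fderiv_right (m := (⊤ : ℕ∞)) (by simp)).differentiable (by simp) p).hasFDerivAt
  have hs : ∀ p, IsSymmSndFDerivAt ℝ Φ p := fun p => hΦs.contDiffAt.isSymmSndFDerivAt (by
    rw [minSmoothness_of_isRCLikeNormedField]
    exact WithTop.coe_le_coe.2 (le_top : (2 : ℕ∞) ≤ ⊤))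
  have hy : ∀ s y, HasFDerivAt (fun y : Fin m → ℝ => (s, y))
      (ContinuousLinearMap.inr ℝ ℝ (Fin m → ℝ)) y := fun s y => hasFDerivAt_prodMk_right s y
  have ht : ∀ s y, HasDerivAt (fun s : ℝ => (s, y)) ((1 : ℝ), (0 : Fin m → ℝ)) s := fun s y =>
    (hasDerivAt_id s).prodMk (hasDerivAt_const s y)
  have h1 : ∀ s, Fd (F s) α i x = fderiv ℝ Φ (s, x) (0, Pi.single i 1) := fun s => by
    have h : HasFDerivAt (fun y => F s y α)
        ((fderiv ℝ Φ (s, x)).comp (ContinuousLinearMap.inr ℝ ℝ (Fin m → ℝ))) x :=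
      (hΦd (s, x)).comp x (hy s x)
    rw [Fd, pd, h.fderiv]
    rfl
  have h2 : mcv (F t) α = fun y => fderiv ℝ Φ (t, y) (1, 0) := funext fun y => by
    rw [← hMCF]
    exact ((hΦd (t, y)).comp_hasDerivAt t (ht t y)).deriv
  have h3 : pd (mcv (F t) α) i x =
      fderiv ℝ (fderiv ℝ Φ) (t, x) (0, Pi.single i 1) (1, 0) := by
    have h : HasFDerivAt (fun y => fderiv ℝ Φ (t, y))
        ((fderiv ℝ (fderiv ℝ Φ) (t, x)).comp (ContinuousLinearMap.inr ℝ ℝ (Fin m → ℝ))) x :=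
      (hd2 (t, x)).comp x (hy t x)
    have h' := h.clm_apply (hasFDerivAt_const ((1 : ℝ), (0 : Fin m → ℝ)) x)
    rw [h2, pd, h'.fderiv]
    simp
  have h4 : HasDerivAt (fun s => fderiv ℝ Φ (s, x)) (fderiv ℝ (fderiv ℝ Φ) (t, x) (1, 0)) t :=
    (hd2 (t, x)).comp_hasDerivAt t (ht t x)
  have h5 := h4.clm_apply (hasDerivAt_const t ((0 : ℝ), (Pi.single i 1 : Fin m → ℝ)))
  rw [h3, hs (t, x), funext h1]
  exact h5.congr_deriv (by rw [map_zero, add_zero])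

/-- Under mean curvature flow with flat normal bundle, the function `w` defined by
`F*ω = w dμ` for a parallel unit `m`-form `ω` satisfies `d/dt w = Δw + w|A|²`. -/
theorem omega_function_evolution {m n : ℕ}
    (F : ℝ → (Fin m → ℝ) → (Fin n → ℝ)) (T : ℝ) (hT : 0 < T)
    (hF : ContDiff ℝ (⊤ : ℕ∞) (fun p : ℝ × (Fin m → ℝ) => F p.1 p.2))
    (himm : ∀ t ∈ Set.Ico (0 : ℝ) T, ∀ x, 0 < (gMat (F t) x).det)
    (hMCF : ∀ t ∈ Set.Ico (0 : ℝ) T, ∀ x α, deriv (fun s => F s x α) t = mcv (F t) α x)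
    (hflat : ∀ t ∈ Set.Ico (0 : ℝ) T, ∀ (α β : Fin n) (i j : Fin m) (x : Fin m → ℝ),
      normCurv (F t) α β i j x = 0)
    (ω : AlternatingMap ℝ (Fin n → ℝ) ℝ (Fin m))
    (hnorm : (1 / (Nat.factorial m : ℝ))
        * ∑ f : Fin m → Fin n, (ω (fun i => Pi.single (f i) (1 : ℝ))) ^ 2 = 1) :
    ∀ t ∈ Set.Ico (0 : ℝ) T, ∀ x,
      deriv (fun s => ω (fun i => fun α => Fd (F s) α i x) / volDens (F s) x) t =
        lapBel (F t) (fun y => ω (fun i => fun α => Fd (F t) α i y) / volDens (F t) y) x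
          + (ω (fun i => fun α => Fd (F t) α i x) / volDens (F t) x) * normA2 (F t) x := by
  intro t ht x
  have hf : ContDiff ℝ (⊤ : ℕ∞) (F t) := hF.comp (contDiff_prodMk_right t)
  have hd := himm t ht
  have hX : Matrix.HasEntryDerivAt (fun s => frameMat (F s) x) (dmcvMat (F t) x) t :=
    fun i α => hasDerivAt_Fd_of_flow hF (hMCF t ht) x α i
  have h1 := (ω.hasDerivAt_coord (X := fun s => (frameMat (F s) x).row) (X' := (dmcvMat (F t) x).row)
    hX).div_sqrt_gram hX (by rw [← gMat_eq_frameMat_mul]; exact hd x)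
  simp only [← volDens_eq] at h1
  rw [← gMat_eq_frameMat_mul, trace_dmcvMat hf hd] at h1
  have h2 := lapBel_pullback_div_volDens hf hd (fun α β i j => hflat t ht α β i j x) ω
  rw [sum_update_traceCovA hf hd] at h2
  refine h1.deriv.trans ?_
  refine Eq.trans ?_ (congrArg (· + ω (frameMat (F t) x).row / volDens (F t) x * normA2 (F t) x)
    h2.symm)
  ring

end
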